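/- Let r ≥ 2 be an integer. For every real ε > 0 there exist a real δ > 0 and an integer n_0 such that for all integers n > n_0 and m, if G is a simple graph with n vertices and m edges and m > t_r(n) − δ·n², then G contains an r-clique R with Σ_{u∈R} d(u) ≥ (1−ε)·2·r·m/n. -/

import Mathlib

open Finset

/-- The number of edges of a simple graph. -/
noncomputable def edgeCount {V : Type*} (G : SimpleGraph V) : ℕ := Nat.card G.edgeSet

/-- The degree of a vertex. -/
noncomputable def deg {V : Type*} (G : SimpleGraph V) (u : V) : ℕ := Nat.card (G.neighborSet u)

/-- The number of edges `t_r(n)` of the Turán graph `T_r(n)`. -/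
noncomputable def turanEdges (r n : ℕ) : ℕ := edgeCount (SimpleGraph.turanGraph n r)

/-- `v 0, ..., v (k-1)` is a 𝔓-sequence in `G`: each `v i` lies in the common
neighbourhood of the previous terms and has maximum degree among the vertices of
that common neighbourhood (for `i = 0`, the common neighbourhood is the whole
vertex set, so `v 0` is a vertex of maximum degree in `G`). -/
def IsPSeq {V : Type*} (G : SimpleGraph V) {k : ℕ} (v : Fin k → V) : Prop :=
  ∀ i : Fin k,
    (∀ j : Fin k, j < i → G.Adj (v j) (v i)) ∧
    ∀ u : V, (∀ j : Fin k, j < i → G.Adj (v j) u) → deg G u ≤ deg G (v i)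

lemma card_mul_weighted_sum_le {ι : Type*} (s : Finset ι) (k x : ι → ℝ) (hk : ∀ i ∈ s, 0 ≤ k i)
    (hkx : ∀ i ∈ s, k i ≤ 1 - x i) (hsum : ∑ i ∈ s, k i = 1) :
    #s * ∑ i ∈ s, k i * x i ≤ #s - 1 := by
  have h : ∑ i ∈ s, k i * x i ≤ ∑ i ∈ s, (k i - k i ^ 2) :=
    sum_le_sum fun i hi => by nlinarith [hk i hi, hkx i hi]
  rw [sum_sub_distrib, hsum] at h
  have hcs := sq_sum_le_card_mul_sum_sq (s := s) (f := k)
  rw [hsum] at hcs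
  have := mul_le_mul_of_nonneg_left h (Nat.cast_nonneg (α := ℝ) #s)
  linarith

lemma weighted_sum_le_of_le_one_sub {ι : Type*} (s : Finset ι) (k x : ι → ℝ) (a b r θ : ℝ)
    (hr : (#s : ℝ) + 1 = r) (hk : ∀ i ∈ s, 0 ≤ k i) (hx : ∀ i ∈ s, 0 ≤ x i)
    (hkx : ∀ i ∈ s, k i ≤ 1 - x i) (ha : 0 ≤ a) (hb : 0 ≤ b) (hba : b ≤ 1 - a)
    (hsum : ∑ i ∈ s, k i + b = 1) (hθ : 0 ≤ θ)
    (he : 1 - 1 / r - θ ^ 2 ≤ ∑ i ∈ s, k i * x i + b * a) :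
    r * (∑ i ∈ s, k i * x i + b * a) ≤ ∑ i ∈ s, x i + a + r ^ 2 * θ := by
  have hr0 : 0 < r := by rw [← hr]; positivity
  have h : ∑ i ∈ s, k i * x i ≤ ∑ i ∈ s, (k i - k i ^ 2) :=
    sum_le_sum fun i hi => by nlinarith [hk i hi, hkx i hi]
  rw [sum_sub_distrib] at h
  have hdev : ∑ i ∈ s, (k i - 1 / r) ^ 2 + (b - 1 / r) ^ 2 ≤ θ ^ 2 := by
    have hexp : ∑ i ∈ s, (k i - 1 / r) ^ 2
        = ∑ i ∈ s, k i ^ 2 - 2 / r * ∑ i ∈ s, k i + #s * (1 / r) ^ 2 := by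
      rw [mul_sum, ← sum_sub_distrib, ← nsmul_eq_mul, ← sum_const, ← sum_add_distrib]
      exact sum_congr rfl fun i _ => by ring
    have hs : (#s : ℝ) = r - 1 := by linarith
    have hk1 : ∑ i ∈ s, k i = 1 - b := by linarith
    rw [hexp, hs, hk1]
    have : (r - 1) * (1 / r) ^ 2 = 1 / r - (1 / r) ^ 2 := by field_simp
    have h2 : 2 / r * (1 - b) = 2 * (1 / r) - 2 * (1 / r) * b := by ring
    rw [this, h2]
    nlinarith
  have hki : ∀ i ∈ s, k i ≤ 1 / r + θ := fun i hi => by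
    have h1 := single_le_sum (f := fun i => (k i - 1 / r) ^ 2) (fun i _ => sq_nonneg _) hi
    have h2 := abs_le_of_sq_le_sq' (a := k i - 1 / r) (b := θ)
      (by nlinarith [sq_nonneg (b - 1 / r)]) hθ
    linarith [h2.2]
  have hbi : b ≤ 1 / r + θ := by
    have h1 : 0 ≤ ∑ i ∈ s, (k i - 1 / r) ^ 2 := sum_nonneg fun i _ => sq_nonneg _
    have h2 := abs_le_of_sq_le_sq' (a := b - 1 / r) (b := θ) (by linarith) hθ
    linarith [h2.2]
  have hle : ∑ i ∈ s, k i * x i ≤ ∑ i ∈ s, (1 / r * x i + θ) :=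
    sum_le_sum fun i hi => by nlinarith [hk i hi, hkx i hi, hki i hi, hx i hi]
  rw [sum_add_distrib, ← mul_sum, sum_const, nsmul_eq_mul] at hle
  have hble : b * a ≤ 1 / r * a + θ := by nlinarith
  have hfin : ∑ i ∈ s, k i * x i + b * a ≤ 1 / r * (∑ i ∈ s, x i + a) + r * θ := by
    rw [← hr] at hle hble ⊢
    linarith
  calc r * (∑ i ∈ s, k i * x i + b * a)
      ≤ r * (1 / r * (∑ i ∈ s, x i + a) + r * θ) := by gcongr
    _ = _ := by field_simp

lemma weighted_sum_le_of_card_le_sum {ι : Type*} (s : Finset ι) (k x : ι → ℝ) (a b r : ℝ)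
    (hr : (#s : ℝ) + 1 = r) (hkx : ∀ i ∈ s, k i ≤ 1 - x i) (hax : ∀ i ∈ s, a ≤ x i)
    (hsum : ∑ i ∈ s, k i + b = 1) (hS : r - 1 ≤ ∑ i ∈ s, x i + a) :
    r * (∑ i ∈ s, k i * x i + b * a) ≤ ∑ i ∈ s, x i + a := by
  have hr0 : 0 < r := by rw [← hr]; positivity
  have hs : (#s : ℝ) = r - 1 := by linarith
  have hle : ∑ i ∈ s, (k i * x i - a * k i)
      ≤ ∑ i ∈ s, (x i - a - x i ^ 2 + a * x i) :=
    sum_le_sum fun i hi => by nlinarith [hkx i hi, hax i hi]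
  simp only [sum_sub_distrib, sum_add_distrib, ← mul_sum, sum_const, nsmul_eq_mul] at hle
  rw [hs] at hle
  have hb : b = 1 - ∑ i ∈ s, k i := by linarith
  have hcs := sq_sum_le_card_mul_sum_sq (s := s) (f := x)
  rw [hs] at hcs
  have hmin : (r - 1) * a ≤ ∑ i ∈ s, x i := by
    rw [← hs, ← nsmul_eq_mul]
    exact card_nsmul_le_sum _ _ _ hax
  have hsq : (∑ i ∈ s, x i + a) ^ 2 ≤ r * (∑ i ∈ s, x i ^ 2 + a ^ 2) := by
    have hexp : 0 ≤ ∑ i ∈ s, (x i - a) ^ 2 := sum_nonneg fun i _ => sq_nonneg _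
    have : ∑ i ∈ s, (x i - a) ^ 2
        = ∑ i ∈ s, x i ^ 2 - 2 * a * ∑ i ∈ s, x i + (r - 1) * a ^ 2 := by
      rw [mul_sum, ← sum_sub_distrib, ← hs, ← nsmul_eq_mul, ← sum_const, ← sum_add_distrib]
      exact sum_congr rfl fun i _ => by ring
    nlinarith
  set X := ∑ i ∈ s, x i
  set Q := ∑ i ∈ s, x i ^ 2
  have hub : ∑ i ∈ s, k i * x i + b * a ≤ (X + a) - (Q + a ^ 2) + a * (X + a - (r - 1)) := by
    rw [hb]
    linarith
  have hra : r * a * (X + a - (r - 1)) ≤ (X + a) * (X + a - (r - 1)) := by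
    apply mul_le_mul_of_nonneg_right <;> linarith
  have := mul_le_mul_of_nonneg_left hub hr0.le
  nlinarith

lemma weighted_sum_le {ι : Type*} (s : Finset ι) (k x : ι → ℝ) (a b r θ : ℝ)
    (hr : (#s : ℝ) + 1 = r) (hk : ∀ i ∈ s, 0 ≤ k i) (hkx : ∀ i ∈ s, k i ≤ 1 - x i)
    (hax : ∀ i ∈ s, a ≤ x i) (ha : 0 ≤ a) (ha1 : a ≤ 1) (hb : 0 ≤ b)
    (hsum : ∑ i ∈ s, k i + b = 1) (hθ : 0 ≤ θ)
    (he : 1 - 1 / r - θ ^ 2 ≤ ∑ i ∈ s, k i * x i + b * a) :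
    r * (∑ i ∈ s, k i * x i + b * a) ≤ ∑ i ∈ s, x i + a + r ^ 2 * θ := by
  have hx : ∀ i ∈ s, 0 ≤ x i := fun i hi => ha.trans (hax i hi)
  have hr0 : 0 < r := by rw [← hr]; positivity
  rcases le_total (r - 1) (∑ i ∈ s, x i + a) with hS | hS
  · have := weighted_sum_le_of_card_le_sum s k x a b r hr hkx hax hsum hS
    have : 0 ≤ r ^ 2 * θ := by positivity
    linarith
  rcases le_or_gt b (1 - a) with hba | hba
  · exact weighted_sum_le_of_le_one_sub s k x a b r θ hr hk hx hkx ha hb hba hsum hθ he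
  -- Move the excess weight `b - (1 - a)` to the indices in `s`, within their capacities.
  set T := ∑ i ∈ s, (1 - x i - k i) with hT
  have hTt : b - (1 - a) ≤ T := by
    simp only [hT, sum_sub_distrib, sum_const, nsmul_eq_mul]
    linarith
  have hT0 : 0 < T := by linarith
  set c := (b - (1 - a)) / T with hc
  have hc0 : 0 ≤ c := div_nonneg (by linarith) hT0.le
  have hc1 : c ≤ 1 := (div_le_one hT0).2 hTt
  have hcT : c * T = b - (1 - a) := div_mul_cancel₀ _ hT0.ne'
  have hmono : ∑ i ∈ s, k i * x i + b * a
      ≤ ∑ i ∈ s, (k i + c * (1 - x i - k i)) * x i + (1 - a) * a := by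
    have hle : ∑ i ∈ s, (k i * x i + c * (1 - x i - k i) * a)
        ≤ ∑ i ∈ s, (k i + c * (1 - x i - k i)) * x i :=
      sum_le_sum fun i hi => by
        have h1 := mul_nonneg hc0 (sub_nonneg.2 (hkx i hi))
        nlinarith [mul_le_mul_of_nonneg_left (hax i hi) h1]
    rw [sum_add_distrib, ← sum_mul, ← mul_sum, ← hT, hcT] at hle
    linarith
  have hmain := weighted_sum_le_of_le_one_sub s (fun i => k i + c * (1 - x i - k i)) x a (1 - a)
    r θ hr (fun i hi => add_nonneg (hk i hi) (mul_nonneg hc0 (sub_nonneg.2 (hkx i hi)))) hx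
    (fun i hi => by nlinarith [hkx i hi]) ha (by linarith) le_rfl
    (by rw [sum_add_distrib, ← mul_sum, ← hT, hcT]; linarith) hθ (he.trans hmono)
  exact (mul_le_mul_of_nonneg_left hmono hr0.le).trans hmain

lemma deg_eq_degree {V : Type*} [Fintype V] (G : SimpleGraph V) [DecidableRel G.Adj] (u : V) :
    deg G u = G.degree u := by
  rw [deg, Nat.card_eq_fintype_card, SimpleGraph.card_neighborSet_eq_degree]

lemma edgeCount_eq_card_edgeFinset {V : Type*} (G : SimpleGraph V) [Fintype G.edgeSet] :
    edgeCount G = #G.edgeFinset := by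
  rw [edgeCount, Nat.card_eq_fintype_card, SimpleGraph.edgeFinset_card]

lemma sum_deg_eq_two_mul_edgeCount {V : Type*} [Fintype V] (G : SimpleGraph V) :
    ∑ u, deg G u = 2 * edgeCount G := by
  classical
  simp only [deg_eq_degree, edgeCount_eq_card_edgeFinset, G.sum_degrees_eq_twice_card_edges]

lemma mul_sq_le_mul_turanEdges_add (r : ℕ) (hr : 0 < r) (n : ℕ) :
    (r - 1 : ℝ) * n ^ 2 ≤ 2 * r * turanEdges r n + r ^ 3 := by
  induction n using Nat.strong_induction_on with
  | _ n ih =>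
    have hr1 : (1 : ℝ) ≤ r := by exact_mod_cast hr
    rcases lt_or_ge n r with h | h
    · have hn : (n : ℝ) ≤ r := by exact_mod_cast h.le
      have hle : (r - 1 : ℝ) * n ^ 2 ≤ r * r ^ 2 := by gcongr; linarith
      have : (0 : ℝ) ≤ 2 * r * turanEdges r n := by positivity
      linarith [pow_succ' (r : ℝ) 2]
    · obtain ⟨p, rfl⟩ := Nat.exists_eq_add_of_le' h
      have hp := ih p (by omega)
      have hadd : turanEdges r (p + r) = turanEdges r p + p * (r - 1) + r.choose 2 := by
        simp only [turanEdges, edgeCount_eq_card_edgeFinset]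
        exact SimpleGraph.card_edgeFinset_turanGraph_add
      rw [hadd]
      push_cast [Nat.cast_sub hr, Nat.cast_choose_two]
      nlinarith

/-- A partial run of the greedy algorithm that repeatedly picks a vertex of maximum degree in the
common neighbourhood of the vertices chosen so far: `R` is the set of chosen vertices, `U` is their
common neighbourhood, and `k v` is the number of vertices that were discarded when `v` was
chosen. -/
structure IsGreedyRun {V : Type*} [Fintype V] (G : SimpleGraph V) (R U : Finset V)
    (k : V → ℝ) : Prop where
  isClique : G.IsClique (R : Set V)
  adj : ∀ u ∈ U, ∀ v ∈ R, G.Adj u v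
  deg_le : ∀ u ∈ U, ∀ v ∈ R, deg G u ≤ deg G v
  nonneg : ∀ v ∈ R, 0 ≤ k v
  le_sub_deg : ∀ v ∈ R, k v ≤ Fintype.card V - deg G v
  sum_add_card : ∑ v ∈ R, k v + #U = Fintype.card V
  sum_deg_le : ∑ v, (deg G v : ℝ) ≤ ∑ v ∈ R, k v * deg G v + ∑ u ∈ U, (deg G u : ℝ)

namespace IsGreedyRun

variable {V : Type*} [Fintype V] {G : SimpleGraph V} {R U : Finset V} {k : V → ℝ}

lemma empty (G : SimpleGraph V) : IsGreedyRun G ∅ univ 0 := by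
  constructor <;> simp

lemma notMem (h : IsGreedyRun G R U k) {v : V} (hv : v ∈ U) : v ∉ R :=
  fun hR => G.loopless.irrefl v (h.adj v hv v hR)

lemma isClique_insert [DecidableEq V] (h : IsGreedyRun G R U k) {v : V} (hv : v ∈ U) :
    G.IsClique (insert v R : Finset V) := by
  rw [coe_insert]
  exact h.isClique.insert fun u hu _ => h.adj v hv u hu

lemma exists_insert [DecidableEq V] (h : IsGreedyRun G R U k) {v : V} (hv : v ∈ U)
    (hmax : ∀ u ∈ U, deg G u ≤ deg G v) :
    ∃ U' k', IsGreedyRun G (insert v R) U' k' := by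
  classical
  have hvR := h.notMem hv
  have hcard : #{u ∈ U | G.Adj v u} + #{u ∈ U | ¬ G.Adj v u} = #U :=
    card_filter_add_card_filter_not _
  refine ⟨{u ∈ U | G.Adj v u}, Function.update k v #{u ∈ U | ¬ G.Adj v u}, ?_⟩
  have hupd : ∀ w ∈ R, Function.update k v (#{u ∈ U | ¬ G.Adj v u} : ℝ) w = k w :=
    fun w hw => Function.update_of_ne (ne_of_mem_of_not_mem hw hvR) _ _
  refine ⟨h.isClique_insert hv, ?_, ?_, ?_, ?_, ?_, ?_⟩
  · intro u hu w hw
    rw [mem_filter] at hu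
    rcases mem_insert.1 hw with rfl | hw
    · exact hu.2.symm
    · exact h.adj u hu.1 w hw
  · intro u hu w hw
    rw [mem_filter] at hu
    rcases mem_insert.1 hw with rfl | hw
    · exact hmax u hu.1
    · exact h.deg_le u hu.1 w hw
  · intro w hw
    rcases mem_insert.1 hw with rfl | hw
    · simp
    · rw [hupd w hw]
      exact h.nonneg w hw
  · intro w hw
    rcases mem_insert.1 hw with rfl | hw
    · rw [Function.update_self, le_sub_iff_add_le, deg_eq_degree,
        ← SimpleGraph.card_neighborFinset_eq_degree]
      have hdisj : Disjoint {u ∈ U | ¬ G.Adj w u} (G.neighborFinset w) :=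
        disjoint_left.2 fun u hu hu' =>
          (mem_filter.1 hu).2 ((G.mem_neighborFinset w u).1 hu')
      rw [← Nat.cast_add, ← card_union_of_disjoint hdisj]
      exact_mod_cast card_le_univ _
    · rw [hupd w hw]
      exact h.le_sub_deg w hw
  · rw [sum_insert hvR, Function.update_self, sum_congr rfl hupd, ← h.sum_add_card, ← hcard]
    push_cast
    ring
  · have hcongr : ∑ w ∈ R, Function.update k v (#{u ∈ U | ¬ G.Adj v u} : ℝ) w * deg G w
        = ∑ w ∈ R, k w * deg G w := sum_congr rfl fun w hw => by rw [hupd w hw]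
    rw [sum_insert hvR, Function.update_self, hcongr]
    have hsplit := sum_filter_add_sum_filter_not U (G.Adj v) fun u => (deg G u : ℝ)
    have hle : ∑ u ∈ U with ¬ G.Adj v u, (deg G u : ℝ) ≤ #{u ∈ U | ¬ G.Adj v u} * deg G v := by
      rw [← nsmul_eq_mul]
      exact sum_le_card_nsmul _ _ _ fun u hu => by exact_mod_cast hmax u (mem_filter.1 hu).1
    linarith [h.sum_deg_le]

/-- If the greedy algorithm gets stuck, the graph has few edges. -/
lemma card_mul_sum_deg_le (h : IsGreedyRun G R ∅ k) (hV : 0 < Fintype.card V) :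
    #R * (∑ v, (deg G v : ℝ) / (Fintype.card V : ℝ) ^ 2) ≤ #R - 1 := by
  have hn : (0 : ℝ) < Fintype.card V := by exact_mod_cast hV
  have hsum := h.sum_add_card
  have hdeg := h.sum_deg_le
  simp only [card_empty, Nat.cast_zero, add_zero, sum_empty] at hsum hdeg
  refine le_trans ?_ (card_mul_weighted_sum_le R (fun v => k v / Fintype.card V)
    (fun v => deg G v / Fintype.card V) (fun v hv => div_nonneg (h.nonneg v hv) hn.le)
    (fun v hv => ?_) ?_)
  · gcongr
    rw [← sum_div]
    refine (div_le_div_of_nonneg_right hdeg (by positivity)).trans_eq ?_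
    rw [sum_div]
    exact sum_congr rfl fun v _ => by field_simp
  · rw [one_sub_div hn.ne']
    exact div_le_div_of_nonneg_right (h.le_sub_deg v hv) hn.le
  · rw [← sum_div, hsum, div_self hn.ne']

lemma exists_card_eq (hV : 0 < Fintype.card V) (r : ℕ) (hr : 0 < r)
    (hG : 1 - 1 / (r : ℝ) < ∑ v, (deg G v : ℝ) / (Fintype.card V : ℝ) ^ 2) (j : ℕ) (hj : j ≤ r) :
    ∃ R U k, #R = j ∧ U.Nonempty ∧ IsGreedyRun G R U k := by
  classical
  have hstuck : ∀ R k, #R ≤ r → ¬ IsGreedyRun G R ∅ k := by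
    intro R k hR h
    have h1 := h.card_mul_sum_deg_le hV
    have hRr : (#R : ℝ) ≤ r := by exact_mod_cast hR
    have hr0 : (0 : ℝ) < r := by exact_mod_cast hr
    rcases (#R).eq_zero_or_pos with h0 | h0
    · rw [h0] at h1
      norm_num at h1
    · have hR0 : (0 : ℝ) < #R := by exact_mod_cast h0
      have h2 := mul_lt_mul_of_pos_left hG hR0
      have h3 : (#R : ℝ) / r ≤ 1 := (div_le_one hr0).2 hRr
      have h4 : (#R : ℝ) * (1 - 1 / r) = #R - #R / r := by ring
      linarith
  induction j with
  | zero =>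
    refine ⟨∅, univ, 0, rfl, ?_, empty G⟩
    exact univ_nonempty_iff.2 (Fintype.card_pos_iff.1 hV)
  | succ j ih =>
    obtain ⟨R, U, k, hR, hU, h⟩ := ih (by omega)
    obtain ⟨v, hv, hmax⟩ := exists_max_image U (deg G) hU
    obtain ⟨U', k', h'⟩ := h.exists_insert hv hmax
    have hcard : #(insert v R) = j + 1 := by rw [card_insert_of_notMem (h.notMem hv), hR]
    refine ⟨_, U', k', hcard, ?_, h'⟩
    rw [nonempty_iff_ne_empty]
    rintro rfl
    exact hstuck _ _ (hcard.trans_le hj) h'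

end IsGreedyRun

lemma exists_isNClique_le_sum_deg {V : Type*} [Fintype V] (G : SimpleGraph V) (r : ℕ)
    (hr : 2 ≤ r) (θ : ℝ) (hθ : 0 ≤ θ) (hθr : θ * (r : ℝ) < 1) (hV : 0 < Fintype.card V)
    (hG : 1 - 1 / (r : ℝ) - θ ^ 2 ≤ ∑ v, (deg G v : ℝ) / (Fintype.card V : ℝ) ^ 2) :
    ∃ R : Finset V, G.IsNClique r R ∧
      r * ∑ v, (deg G v : ℝ) / (Fintype.card V : ℝ) ^ 2
        ≤ ∑ v ∈ R, (deg G v : ℝ) / Fintype.card V + r ^ 2 * θ := by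
  classical
  have hn : (0 : ℝ) < Fintype.card V := by exact_mod_cast hV
  obtain ⟨p, rfl⟩ : ∃ p, r = p + 1 := ⟨r - 1, by omega⟩
  have hp : (1 : ℝ) ≤ p := by exact_mod_cast (by omega : 1 ≤ p)
  obtain ⟨R, U, k, hR, hU, h⟩ := IsGreedyRun.exists_card_eq (G := G) hV p (by omega) (by
    refine lt_of_lt_of_le ?_ hG
    have h1 : θ ^ 2 * (p + 1 : ℝ) ^ 2 < 1 := by
      push_cast at hθr
      rw [← mul_pow]
      exact pow_lt_one₀ (by positivity) hθr two_ne_zero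
    have h2 : θ ^ 2 < 1 / p - 1 / (p + 1 : ℝ) := by
      have h3 : 1 / p - 1 / (p + 1 : ℝ) = 1 / (p * (p + 1)) := by field_simp; ring
      rw [h3, lt_div_iff₀ (by positivity)]
      nlinarith [sq_nonneg θ]
    push_cast
    linarith) p le_rfl
  obtain ⟨v, hv, hmax⟩ := exists_max_image U (deg G) hU
  have hvR := h.notMem hv
  refine ⟨insert v R, ⟨h.isClique_insert hv, by rw [card_insert_of_notMem hvR, hR]⟩, ?_⟩
  rw [sum_insert hvR, add_comm (_ / _)]
  have hUle : ∑ u ∈ U, (deg G u : ℝ) ≤ #U * deg G v := by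
    rw [← nsmul_eq_mul]
    exact sum_le_card_nsmul _ _ _ fun u hu => by exact_mod_cast hmax u hu
  have hle : ∑ v, (deg G v : ℝ) / (Fintype.card V : ℝ) ^ 2
      ≤ ∑ u ∈ R, k u / Fintype.card V * (deg G u / Fintype.card V)
        + #U / Fintype.card V * (deg G v / Fintype.card V) := by
    rw [← sum_div]
    refine (div_le_div_of_nonneg_right (h.sum_deg_le.trans (add_le_add_right hUle _))
      (by positivity)).trans_eq ?_
    rw [add_div, sum_div]
    congr 1
    · exact sum_congr rfl fun v _ => by field_simp
    · field_simp
  refine (mul_le_mul_of_nonneg_left hle (by positivity)).trans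
    (weighted_sum_le R (fun u => k u / Fintype.card V) (fun u => deg G u / Fintype.card V) _ _ _ θ
      (by rw [hR]; push_cast; rfl) (fun u hu => div_nonneg (h.nonneg u hu) hn.le) (fun u hu => ?_)
      (fun u hu => ?_) (by positivity) ?_ (by positivity) ?_ hθ (hG.trans hle))
  · rw [one_sub_div hn.ne']
    exact div_le_div_of_nonneg_right (h.le_sub_deg u hu) hn.le
  · exact div_le_div_of_nonneg_right (by exact_mod_cast h.deg_le v hv u hu) hn.le
  · refine (div_le_one hn).2 ?_
    rw [deg_eq_degree]
    exact_mod_cast (G.degree_lt_card_verts v).le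
  · rw [← sum_div, ← add_div, h.sum_add_card, div_self hn.ne']

/-- For r ≥ 2 and every ε > 0 there are δ > 0 and n₀ such that every
graph with n > n₀ vertices and m > t_r(n) − δ·n² edges contains an r-clique whose
degree sum is at least (1−ε)·2·r·m/n. -/
theorem stability (r : ℕ) (hr : 2 ≤ r) (ε : ℝ) (hε : 0 < ε) :
    ∃ δ : ℝ, 0 < δ ∧ ∃ n₀ : ℕ, ∀ n m : ℕ, n₀ < n →
      ∀ G : SimpleGraph (Fin n), edgeCount G = m →
        (turanEdges r n : ℝ) - δ * n ^ 2 < m →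
        ∃ R : Finset (Fin n), G.IsNClique r R ∧
          (1 - ε) * (2 * r * m) / n ≤ ∑ u ∈ R, (deg G u : ℝ) := by
  have hr2 : (2 : ℝ) ≤ r := by exact_mod_cast hr
  set θ : ℝ := min (1 / (2 * r)) (ε / (4 * r))
  have hθ : 0 < θ := lt_min (by positivity) (by positivity)
  have hθr : θ * r ≤ 1 / 2 := by
    calc θ * r ≤ 1 / (2 * r) * r := by gcongr; exact min_le_left _ _
      _ = 1 / 2 := by field_simp
  have hθε : r * θ ≤ ε / 4 := by
    calc r * θ ≤ r * (ε / (4 * r)) := by gcongr; exact min_le_right _ _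
      _ = ε / 4 := by field_simp
  refine ⟨θ ^ 2 / 4, by positivity, ⌈2 * r ^ 2 / θ ^ 2⌉₊, fun n m hn G hGm hm => ?_⟩
  have hn1 : (1 : ℝ) ≤ n := by exact_mod_cast (by omega : 1 ≤ n)
  have hn0 : (0 : ℝ) < n := by linarith
  have hnr : 2 * (r : ℝ) ^ 2 ≤ θ ^ 2 * n ^ 2 := by
    have h1 : 2 * (r : ℝ) ^ 2 / θ ^ 2 ≤ n := (Nat.le_ceil _).trans (by exact_mod_cast hn.le)
    rw [div_le_iff₀ (by positivity)] at h1
    nlinarith [sq_nonneg θ, mul_nonneg (sq_nonneg θ) (mul_nonneg hn0.le (sub_nonneg.2 hn1))]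
  have hsum : ∑ v, (deg G v : ℝ) / (n : ℝ) ^ 2 = 2 * m / n ^ 2 := by
    rw [← sum_div, ← hGm]
    congr 1
    exact_mod_cast sum_deg_eq_two_mul_edgeCount G
  have hlow : 1 - 1 / (r : ℝ) - θ ^ 2 ≤ 2 * m / n ^ 2 := by
    rw [le_div_iff₀ (by positivity)]
    have h1 := mul_sq_le_mul_turanEdges_add r (by omega) n
    have h2 : (1 - 1 / (r : ℝ)) * n ^ 2 ≤ 2 * turanEdges r n + r ^ 2 := by
      have h3 : (1 - 1 / (r : ℝ)) * n ^ 2 = (r - 1) * n ^ 2 / r := by field_simp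
      rw [h3, div_le_iff₀ (by positivity)]
      linarith
    nlinarith
  obtain ⟨R, hR, hle⟩ := exists_isNClique_le_sum_deg G r hr θ hθ.le (by linarith)
    (by simpa using hn.pos) (by simpa only [Fintype.card_fin, hsum] using hlow)
  refine ⟨R, hR, ?_⟩
  rw [Fintype.card_fin, hsum, ← sum_div] at hle
  have hquarter : 1 / 4 ≤ 2 * (m : ℝ) / n ^ 2 := by
    have h1 : 1 / (r : ℝ) ≤ 1 / 2 := one_div_le_one_div_of_le two_pos hr2
    nlinarith
  have herr : r ^ 2 * θ ≤ ε * (r * (2 * m / n ^ 2)) := by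
    have h1 : r * θ ≤ ε * (2 * m / n ^ 2) := by nlinarith
    have h2 := mul_le_mul_of_nonneg_left h1 (by positivity : (0 : ℝ) ≤ r)
    linarith
  have hfin : (1 - ε) * (r * (2 * m / n ^ 2)) ≤ (∑ v ∈ R, (deg G v : ℝ)) / n := by linarith
  rw [le_div_iff₀ hn0] at hfin
  refine le_trans (le_of_eq ?_) hfin
  field_simp
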